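/- If T = {T_{m,k} : k,m ≤ n} and S = {S_{j,i} : i,j ≤ n} are two finite systems of matrix units in B(ℓ²) and there exist pairwise orthogonal norm-one vectors (e_i^k : i,k ≤ n) with T_{m,k}(e_i^{k'}) = δ_{k,k'} e_i^m and S_{j,i}(e_{i'}^k) = δ_{i,i'} e_j^k for all indices, then for every A in C*(T) and B in C*(S) one has ‖AB‖ = ‖A‖‖B‖. -/

import Mathlib

/-- The (non-unital) C*-subalgebra of `B(H)` generated by a set of operators. -/
noncomputable def genCStar {H : Type*} [NormedAddCommGroup H] [InnerProductSpace ℂ H]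
    [CompleteSpace H] (s : Set (H →L[ℂ] H)) : NonUnitalStarSubalgebra ℂ (H →L[ℂ] H) :=
  (NonUnitalStarAlgebra.adjoin ℂ s).topologicalClosure

open scoped Matrix.Norms.L2Operator

/-- The star homomorphism from a full matrix algebra determined by a system of matrix units. -/
noncomputable def matrixUnitsHom {ι A : Type*} [Fintype ι] [DecidableEq ι] [Ring A] [StarRing A]
    [Algebra ℂ A] [StarModule ℂ A] (T : ι → ι → A) (hstar : ∀ j i, star (T j i) = T i j)
    (hmul : ∀ l m j i, T l m * T j i = if m = j then T l i else 0) :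
    Matrix ι ι ℂ →⋆ₙₐ[ℂ] A where
  toFun a := ∑ m, ∑ k, a m k • T m k
  map_smul' c a := by simp [Finset.smul_sum, mul_smul]
  map_zero' := by simp
  map_add' a b := by simp [add_smul, Finset.sum_add_distrib]
  map_mul' a b := by
    have hrow (m l) : T m l * ∑ j, ∑ k, b j k • T j k = ∑ k, b l k • T m k := by
      simp only [Finset.mul_sum, mul_smul_comm, hmul, smul_ite, smul_zero]
      rw [Finset.sum_comm]
      simp
    simp only [Finset.sum_mul, smul_mul_assoc, hrow, Matrix.mul_apply, Finset.sum_smul,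
      Finset.smul_sum, smul_smul]
    exact Finset.sum_congr rfl fun m _ => Finset.sum_comm
  map_star' a := by
    simp only [star_sum, star_smul, hstar, Matrix.star_apply]
    exact Finset.sum_comm

/-- An element of the C*-algebra generated by a finite system of matrix units is the image of a
matrix, whose operator norm bounds its norm. -/
theorem exists_matrix_of_mem_genCStar {ι H : Type*} [Fintype ι] [DecidableEq ι]
    [NormedAddCommGroup H] [InnerProductSpace ℂ H] [CompleteSpace H]
    (T : ι → ι → (H →L[ℂ] H)) (hstar : ∀ j i, star (T j i) = T i j)
    (hmul : ∀ l m j i, T l m * T j i = if m = j then T l i else 0) {A : H →L[ℂ] H}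
    (hA : A ∈ genCStar (Set.range fun p : ι × ι => T p.1 p.2)) :
    ∃ a : Matrix ι ι ℂ, A = ∑ m, ∑ k, a m k • T m k ∧ ‖A‖ ≤ ‖a‖ := by
  set φ := matrixUnitsHom T hstar hmul
  have hclosed : IsClosed (NonUnitalStarAlgHom.range φ : Set (H →L[ℂ] H)) :=
    Submodule.closed_of_finiteDimensional
      (LinearMap.range (φ : Matrix ι ι ℂ →ₗ[ℂ] (H →L[ℂ] H)))
  have hle : genCStar (Set.range fun p : ι × ι => T p.1 p.2) ≤ NonUnitalStarAlgHom.range φ := by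
    refine NonUnitalStarSubalgebra.topologicalClosure_minimal _
      (NonUnitalStarAlgebra.adjoin_le ?_) hclosed
    rintro _ ⟨⟨j, i⟩, rfl⟩
    refine ⟨Matrix.single j i 1, ?_⟩
    change ∑ m, ∑ k, Matrix.single j i (1 : ℂ) m k • T m k = T j i
    simp [Matrix.single_apply, ite_and]
  obtain ⟨a, rfl⟩ := hle hA
  exact ⟨a, rfl, NonUnitalStarAlgHom.norm_apply_le φ a⟩

/-- An elementary tensor of coefficient vectors, expanded in an orthonormal family, has the product
norm. -/
theorem Orthonormal.norm_sum_mul_smul {ι κ H : Type*} [Fintype ι] [Fintype κ]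
    [NormedAddCommGroup H] [InnerProductSpace ℂ H] {e : ι → κ → H}
    (he : Orthonormal ℂ fun p : ι × κ => e p.1 p.2)
    (x : EuclideanSpace ℂ ι) (y : EuclideanSpace ℂ κ) :
    ‖∑ i, ∑ k, (x i * y k) • e i k‖ = ‖x‖ * ‖y‖ := by
  rw [← sq_eq_sq₀ (norm_nonneg _) (by positivity), mul_pow, EuclideanSpace.norm_sq_eq,
    EuclideanSpace.norm_sq_eq, Finset.sum_mul_sum]
  rw [← Fintype.sum_prod_type' (f := fun i k => (x i * y k) • e i k),
    ← Fintype.sum_prod_type' (f := fun i k => ‖x i‖ ^ 2 * ‖y k‖ ^ 2)]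
  have h := he.inner_sum (fun p => x p.1 * y p.2) (fun p => x p.1 * y p.2) Finset.univ
  rw [inner_self_eq_norm_sq_to_K] at h
  simp only [RCLike.conj_mul, norm_mul] at h
  simp only [← mul_pow]
  exact_mod_cast h

/-- A two-variable criterion bounding the product of two operator norms. -/
theorem ContinuousLinearMap.opNorm_mul_opNorm_le {E F G K : Type*}
    [NormedAddCommGroup E] [NormedSpace ℂ E] [NormedAddCommGroup F] [NormedSpace ℂ F]
    [NormedAddCommGroup G] [NormedSpace ℂ G] [NormedAddCommGroup K] [NormedSpace ℂ K]
    (f : E →L[ℂ] F) (g : G →L[ℂ] K) {C : ℝ} (hC : 0 ≤ C)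
    (h : ∀ x y, ‖f x‖ * ‖g y‖ ≤ C * (‖x‖ * ‖y‖)) : ‖f‖ * ‖g‖ ≤ C := by
  have hf : ∀ y, ‖f‖ * ‖g y‖ ≤ C * ‖y‖ := fun y => by
    have := ((‖g y‖ : ℂ) • f).opNorm_le_bound (M := C * ‖y‖) (by positivity) fun x => by
      simpa [norm_smul, mul_comm, mul_left_comm, mul_assoc] using h x y
    simpa [norm_smul, mul_comm] using this
  have := ((‖f‖ : ℂ) • g).opNorm_le_bound (M := C) hC fun y => by
    simpa [norm_smul] using hf y
  simpa [norm_smul] using this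

/-- if `T` and `S` are finite systems of matrix units acting on a doubly
indexed orthonormal system `e` as prescribed, then `‖A * B‖ = ‖A‖ * ‖B‖` for all
`A ∈ C*(T)`, `B ∈ C*(S)`. -/
theorem stmt0 {H : Type*} [NormedAddCommGroup H] [InnerProductSpace ℂ H] [CompleteSpace H]
    (n : ℕ) (T S : Fin (n + 1) → Fin (n + 1) → (H →L[ℂ] H))
    (hT0 : ∀ m k, T m k ≠ 0) (hS0 : ∀ j i, S j i ≠ 0)
    (hTstar : ∀ j i, star (T j i) = T i j)
    (hTmul : ∀ n' m j i, T n' m * T j i = if m = j then T n' i else 0)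
    (hSstar : ∀ j i, star (S j i) = S i j)
    (hSmul : ∀ n' m j i, S n' m * S j i = if m = j then S n' i else 0)
    -- `e i k` is the vector `e_i^k` (lower index `i`, upper index `k`)
    (e : Fin (n + 1) → Fin (n + 1) → H)
    (he : Orthonormal ℂ (fun p : Fin (n + 1) × Fin (n + 1) => e p.1 p.2))
    (hTe : ∀ m k i k', T m k (e i k') = if k = k' then e i m else 0)
    (hSe : ∀ j i k i', S j i (e i' k) = if i = i' then e j k else 0)
    (A B : H →L[ℂ] H)
    (hA : A ∈ genCStar (Set.range fun p : Fin (n + 1) × Fin (n + 1) => T p.1 p.2))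
    (hB : B ∈ genCStar (Set.range fun p : Fin (n + 1) × Fin (n + 1) => S p.1 p.2)) :
    ‖A * B‖ = ‖A‖ * ‖B‖ := by
  obtain ⟨a, rfl, ha⟩ := exists_matrix_of_mem_genCStar T hTstar hTmul hA
  obtain ⟨b, rfl, hb⟩ := exists_matrix_of_mem_genCStar S hSstar hSmul hB
  set A := ∑ m, ∑ k, a m k • T m k with hAdef
  set B := ∑ m, ∑ k, b m k • S m k with hBdef
  let v (x y : EuclideanSpace ℂ (Fin (n + 1))) : H := ∑ i, ∑ k, (x i * y k) • e i k
  have hAe (i k) : A (e i k) = ∑ m, a m k • e i m := by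
    simp [hAdef, hTe]
  have hBe (i k) : B (e i k) = ∑ j, b j i • e j k := by
    simp [hBdef, hSe]
  have hAv (x y) : A (v x y) = v x (Matrix.toEuclideanCLM (𝕜 := ℂ) a y) := by
    simp only [v, map_sum, map_smul, hAe, Matrix.ofLp_toEuclideanCLM, Matrix.mulVec, dotProduct,
      Finset.mul_sum, Finset.sum_smul, Finset.smul_sum, smul_smul]
    refine Finset.sum_congr rfl fun i _ => ?_
    rw [Finset.sum_comm]
    refine Finset.sum_congr rfl fun m _ => Finset.sum_congr rfl fun k _ => ?_
    congr 1
    ring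
  have hBv (x y) : B (v x y) = v (Matrix.toEuclideanCLM (𝕜 := ℂ) b x) y := by
    simp only [v, map_sum, map_smul, hBe, Matrix.ofLp_toEuclideanCLM, Matrix.mulVec, dotProduct,
      Finset.sum_mul, Finset.sum_smul, Finset.smul_sum, smul_smul]
    rw [Finset.sum_comm, Finset.sum_comm (s := Finset.univ) (t := Finset.univ)
      (f := fun j k => ∑ i, (b j i * x i * y k) • e j k)]
    refine Finset.sum_congr rfl fun k _ => ?_
    rw [Finset.sum_comm]
    refine Finset.sum_congr rfl fun j _ => Finset.sum_congr rfl fun i _ => ?_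
    congr 1
    ring
  refine le_antisymm (norm_mul_le A B) ((mul_le_mul ha hb (norm_nonneg _) (norm_nonneg _)).trans ?_)
  rw [← Matrix.l2_opNorm_toEuclideanCLM a, ← Matrix.l2_opNorm_toEuclideanCLM b]
  refine ContinuousLinearMap.opNorm_mul_opNorm_le _ _ (norm_nonneg _) fun y x => ?_
  have h := (A * B).le_opNorm (v x y)
  rw [mul_apply_eq_comp, hBv, hAv] at h
  rw [he.norm_sum_mul_smul, he.norm_sum_mul_smul] at h
  linarith [mul_comm ‖x‖ ‖y‖]
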